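/- arXiv:1602.03943 — 4 statements merged into one kernel-verified Lean document; each statement's English description precedes it below -/
import Mathlib

section
/- Let A₁, …, A_m be d×d real matrices and let Ā = (1/m)·∑_{k=1}^m A_k. For a sequence s : {1,…,j} → {1,…,m} define matrices D_0(s), …, D_j(s) recursively by D_0(s) = I and D_t(s) = I + (I − A_{s(t)})·D_{t−1}(s) for 1 ≤ t ≤ j. Then the average over all m^j sequences satisfies (1/m^j)·∑_{s ∈ {1,…,m}^j} D_j(s) = ∑_{i=0}^{j} (I − Ā)^i. (That is, the recursive LiSSA estimator of depth j is an unbiased estimator of the truncated Neumann series ∑_{i=0}^{j} (I − Ā)^i.) -/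
open Matrix Finset

/-- The depth-`t` recursion `D_0 = 1`, `D_{t+1} = 1 + B_{s(t)} * D_t` along a sample sequence. -/
def neumannEstimator {R ι : Type*} [Semiring R] (B : ι → R) : (t : ℕ) → (Fin t → ι) → R
  | 0, _ => 1
  | t + 1, s => 1 + B (s (Fin.last t)) * neumannEstimator B t (Fin.init s)

/-- Summing over all sample sequences gives a multiple of the truncated Neumann series of any
`b` for which `∑ k, B k = card ι • b`. -/
theorem sum_neumannEstimator {R ι : Type*} [Semiring R] [Fintype ι] (B : ι → R) (b : R)
    (hb : ∑ k, B k = Fintype.card ι • b) (j : ℕ) :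
    ∑ s : Fin j → ι, neumannEstimator B j s =
      Fintype.card ι ^ j • ∑ i ∈ Finset.range (j + 1), b ^ i := by
  induction j with
  | zero => simp [neumannEstimator]
  | succ j ih =>
    rw [← (Fin.snocEquiv fun _ : Fin (j + 1) => ι).sum_comp, Fintype.sum_prod_type]
    have hterm (k : ι) (s : Fin j → ι) :
        neumannEstimator B (j + 1) (Fin.snocEquiv (fun _ : Fin (j + 1) => ι) (k, s)) =
          1 + B k * neumannEstimator B j s := by
      simp [neumannEstimator, Fin.snocEquiv]
    simp only [hterm, Finset.sum_add_distrib, ← Finset.mul_sum, ← Finset.sum_mul, ih, hb]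
    rw [Finset.sum_range_succ' _ (j + 1)]
    simp only [pow_succ' b, ← Finset.mul_sum, pow_zero, smul_add, smul_mul_smul_comm]
    simp [pow_succ', add_comm]

theorem eq_neumannEstimator {R ι : Type*} [Semiring R] {j : ℕ} (B : ι → R) (s : Fin j → ι)
    (D : ℕ → R) (hD0 : D 0 = 1)
    (hDrec : ∀ (t : ℕ) (ht : t < j), D (t + 1) = 1 + B (s ⟨t, ht⟩) * D t)
    (t : ℕ) (ht : t ≤ j) : D t = neumannEstimator B t (fun i => s (i.castLE ht)) := by
  induction t with
  | zero => exact hD0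
  | succ t ih =>
    rw [hDrec t ht, ih (Nat.le_of_succ_le ht)]
    rfl

/-- the recursive LiSSA estimator of depth `j`, defined by
`D_0(s) = I`, `D_t(s) = I + (I − A_{s(t)})·D_{t−1}(s)`, averaged over all `m^j`
sample sequences `s`, equals the truncated Neumann series `∑_{i=0}^{j} (I − Ā)^i`
where `Ā = (1/m)·∑_k A_k`. -/
theorem lissa_estimator_unbiased {d m j : ℕ} (hm : 1 ≤ m)
    (A : Fin m → Matrix (Fin d) (Fin d) ℝ)
    (Abar : Matrix (Fin d) (Fin d) ℝ)
    (hAbar : Abar = (1 / (m : ℝ)) • ∑ k : Fin m, A k)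
    (D : (Fin j → Fin m) → ℕ → Matrix (Fin d) (Fin d) ℝ)
    (hD0 : ∀ s, D s 0 = 1)
    (hDrec : ∀ s (t : ℕ) (ht : t < j),
      D s (t + 1) = 1 + (1 - A (s ⟨t, ht⟩)) * D s t) :
    ((1 : ℝ) / (m : ℝ) ^ j) • ∑ s : Fin j → Fin m, D s j =
      ∑ i ∈ Finset.range (j + 1), (1 - Abar) ^ i := by
  have hm0 : (m : ℝ) ≠ 0 := by positivity
  have hsum : ∑ k, (1 - A k) = Fintype.card (Fin m) • (1 - Abar) := by
    rw [hAbar, ← Nat.cast_smul_eq_nsmul ℝ, smul_sub, smul_smul]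
    simp [hm0, Nat.cast_smul_eq_nsmul]
  have hD (s : Fin j → Fin m) : D s j = neumannEstimator (fun k => 1 - A k) j s :=
    eq_neumannEstimator (fun k => 1 - A k) s (D s) (hD0 s) (hDrec s) j le_rfl
  simp only [hD]
  rw [sum_neumannEstimator _ _ hsum, ← Nat.cast_smul_eq_nsmul ℝ, smul_smul]
  simp [hm0]
end

section
/- Let A be a d×d real symmetric positive definite matrix and β > 0. Let f₁, …, f_m : ℝ^d → ℝ be differentiable convex functions, each β-smooth with respect to A, and let f = (1/m)·∑_{k=1}^m f_k. Suppose x* ∈ ℝ^d satisfies ∇f(x*) = 0. Then for all x, x̃ ∈ ℝ^d, letting v_k = ∇f_k(x) − ∇f_k(x̃) + ∇f(x̃), one has (1/m)·∑_{k=1}^m ⟨v_k, A⁻¹·v_k⟩ ≤ 4β·( (f(x) − f(x*)) + (f(x̃) − f(x*)) ). -/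
open Matrix Finset
open scoped RealInnerProductSpace

section InnerProductSpace

variable {E : Type*} [NormedAddCommGroup E] [InnerProductSpace ℝ E]

/-- A convex function lies above its tangent hyperplanes. -/
theorem ConvexOn.add_inner_gradient_le [CompleteSpace E] {f : E → ℝ}
    (hf : ConvexOn ℝ Set.univ f) {x : E} (hx : DifferentiableAt ℝ f x) (y : E) :
    f x + ⟪gradient f x, y - x⟫ ≤ f y := by
  have hline : HasDerivAt (AffineMap.lineMap x y : ℝ → E) (y - x) 0 :=
    AffineMap.hasDerivAt_lineMap
  have hfx : HasFDerivAt f (fderiv ℝ f x) (AffineMap.lineMap x y (0 : ℝ)) := by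
    simpa using hx.hasFDerivAt
  have hderiv := hfx.comp_hasDerivAt 0 hline
  have hconv : ConvexOn ℝ Set.univ (f ∘ (AffineMap.lineMap x y : ℝ →ᵃ[ℝ] E)) := by
    simpa using hf.comp_affineMap (AffineMap.lineMap x y : ℝ →ᵃ[ℝ] E)
  have hslope := hconv.le_slope_of_hasDerivAt (Set.mem_univ 0) (Set.mem_univ 1) one_pos hderiv
  simp only [slope_def_field, Function.comp_apply, AffineMap.lineMap_apply_zero,
    AffineMap.lineMap_apply_one, sub_zero, div_one] at hslope
  rw [inner_gradient_left]
  linarith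

/-- Co-coercivity: for a convex function that is `β`-smooth in the norm of `Q`, the gradient
difference in the norm of a right inverse `P` of `Q` is bounded by the Bregman divergence. -/
theorem ConvexOn.inner_gradient_sub_le [CompleteSpace E] {f : E → ℝ} {P Q : E →L[ℝ] E} {β : ℝ}
    (hβ : 0 < β) (hQP : ∀ v, Q (P v) = v) (hf : ConvexOn ℝ Set.univ f)
    (hdiff : Differentiable ℝ f)
    (hsmooth : ∀ x y, f y ≤ f x + ⟪gradient f x, y - x⟫ + β / 2 * ⟪y - x, Q (y - x)⟫)
    (x y : E) :
    ⟪gradient f y - gradient f x, P (gradient f y - gradient f x)⟫ ≤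
      2 * β * (f y - f x - ⟪gradient f x, y - x⟫) := by
  set h := gradient f y - gradient f x with hh
  have hupper := hsmooth y (y - β⁻¹ • P h)
  have hlower := hf.add_inner_gradient_le (hdiff x) (y - β⁻¹ • P h)
  have hy : y - β⁻¹ • P h - y = -(β⁻¹ • P h) := by abel
  have hx : y - β⁻¹ • P h - x = (y - x) - β⁻¹ • P h := by abel
  have hsub : ⟪h, P h⟫ = ⟪gradient f y, P h⟫ - ⟪gradient f x, P h⟫ := by
    rw [← inner_sub_left]
  rw [hy] at hupper
  rw [hx] at hlower
  simp only [map_neg, map_smul, inner_neg_left, inner_neg_right, inner_smul_left,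
    inner_smul_right, hQP, RCLike.conj_to_real, inner_sub_right] at hupper hlower
  rw [real_inner_comm h (P h)] at hupper
  have hquad : β / 2 * (β⁻¹ * (β⁻¹ * ⟪h, P h⟫)) = β⁻¹ * ⟪h, P h⟫ / 2 := by
    field_simp
  have key : β⁻¹ * ⟪h, P h⟫ / 2 ≤ f y - f x - ⟪gradient f x, y - x⟫ := by
    have hmul : β⁻¹ * ⟪h, P h⟫ = β⁻¹ * ⟪gradient f y, P h⟫ - β⁻¹ * ⟪gradient f x, P h⟫ := by
      rw [hsub]; ring
    rw [inner_sub_right]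
    linarith
  calc ⟪h, P h⟫ = 2 * β * (β⁻¹ * ⟪h, P h⟫ / 2) := by field_simp
    _ ≤ _ := by gcongr

theorem inner_map_sub_le_two_mul {P : E →L[ℝ] E} (hP : ∀ v, 0 ≤ ⟪v, P v⟫) (u w : E) :
    ⟪u - w, P (u - w)⟫ ≤ 2 * ⟪u, P u⟫ + 2 * ⟪w, P w⟫ := by
  have h := hP (u + w)
  simp only [map_add, map_sub, inner_add_left, inner_add_right, inner_sub_left,
    inner_sub_right] at h ⊢
  linarith

/-- Centering a finite family at its mean does not increase the sum of its quadratic form. -/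
theorem sum_inner_map_sub_mean_le {ι : Type*} [Fintype ι] {P : E →L[ℝ] E}
    (hP : ∀ v, 0 ≤ ⟪v, P v⟫) (b : ι → E) {c : E}
    (hc : ∑ k, b k = (Fintype.card ι : ℝ) • c) :
    ∑ k, ⟪b k - c, P (b k - c)⟫ ≤ ∑ k, ⟪b k, P (b k)⟫ := by
  have hleft : ∑ k, ⟪b k, P c⟫ = Fintype.card ι * ⟪c, P c⟫ := by
    rw [← sum_inner, hc, real_inner_smul_left]
  have hright : ∑ k, ⟪c, P (b k)⟫ = Fintype.card ι * ⟪c, P c⟫ := by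
    rw [← inner_sum, ← map_sum, hc, map_smul, real_inner_smul_right]
  have hnonneg : 0 ≤ Fintype.card ι * ⟪c, P c⟫ := mul_nonneg (Nat.cast_nonneg _) (hP c)
  simp only [map_sub, inner_sub_left, inner_sub_right, Finset.sum_sub_distrib, hleft, hright,
    Finset.sum_const, Finset.card_univ, nsmul_eq_mul]
  linarith

theorem gradient_const_mul_sum [CompleteSpace E] {ι : Type*} [Fintype ι] {f : ι → E → ℝ} {x : E}
    (hf : ∀ k, DifferentiableAt ℝ (f k) x) (c : ℝ) :
    gradient (fun y => c * ∑ k, f k y) x = c • ∑ k, gradient (f k) x := by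
  refine HasGradientAt.gradient ?_
  rw [hasGradientAt_iff_hasFDerivAt, map_smul, map_sum]
  exact (HasFDerivAt.fun_sum fun k _ => (hf k).hasGradientAt.hasFDerivAt).const_mul c

end InnerProductSpace

/-- variance bound for the SVRG variance-reduced gradients
`v_k = ∇f_k(x) − ∇f_k(x̃) + ∇f(x̃)` in the `A⁻¹`-norm: if each `f_k` is convex,
differentiable and `β`-smooth w.r.t. a symmetric positive definite matrix `A`,
`f = (1/m)·∑ f_k`, and `∇f(x*) = 0`, then
`(1/m)·∑_k ⟨v_k, A⁻¹·v_k⟩ ≤ 4β·((f(x) − f(x*)) + (f(x̃) − f(x*)))`. -/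
theorem svrg_variance_bound {d m : ℕ} (hm : 1 ≤ m)
    (A : Matrix (Fin d) (Fin d) ℝ) (hAsymm : A.IsSymm) (hA : A.PosDef)
    (β : ℝ) (hβ : 0 < β)
    (f : Fin m → EuclideanSpace ℝ (Fin d) → ℝ)
    (hdiff : ∀ k, Differentiable ℝ (f k))
    (hconv : ∀ k, ConvexOn ℝ Set.univ (f k))
    (hsmooth : ∀ k, ∀ x y : EuclideanSpace ℝ (Fin d),
      f k y ≤ f k x + ⟪gradient (f k) x, y - x⟫ +
        β / 2 * ⟪y - x, Matrix.toEuclideanCLM (𝕜 := ℝ) A (y - x)⟫)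
    (F : EuclideanSpace ℝ (Fin d) → ℝ)
    (hF : F = fun x => (1 / (m : ℝ)) * ∑ k : Fin m, f k x)
    (xstar : EuclideanSpace ℝ (Fin d)) (hstar : gradient F xstar = 0)
    (x xtil : EuclideanSpace ℝ (Fin d)) :
    (1 / (m : ℝ)) * ∑ k : Fin m,
        ⟪gradient (f k) x - gradient (f k) xtil + gradient F xtil,
          Matrix.toEuclideanCLM (𝕜 := ℝ) A⁻¹
            (gradient (f k) x - gradient (f k) xtil + gradient F xtil)⟫ ≤
      4 * β * ((F x - F xstar) + (F xtil - F xstar)) := by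
  set Q := Matrix.toEuclideanCLM (n := Fin d) (𝕜 := ℝ) A
  set P := Matrix.toEuclideanCLM (n := Fin d) (𝕜 := ℝ) A⁻¹
  have hQP : ∀ v, Q (P v) = v := fun v => by
    rw [← mul_apply_eq_comp, ← map_mul,
      Matrix.mul_nonsing_inv A ((Matrix.isUnit_iff_isUnit_det A).1 hA.isUnit), map_one,
      one_apply_eq_self]
  have hP : ∀ v, 0 ≤ ⟪v, P v⟫ := fun v => by
    rw [Matrix.inner_toEuclideanCLM]
    simpa using hA.inv.posSemidef.dotProduct_mulVec_nonneg v.ofLp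
  have hm0 : (m : ℝ) ≠ 0 := Nat.cast_ne_zero.2 (by omega)
  have hgrad : ∀ y, ∑ k, gradient (f k) y = (m : ℝ) • gradient F y := fun y => by
    rw [hF, gradient_const_mul_sum (fun k => hdiff k y), smul_smul, mul_one_div_cancel hm0,
      one_smul]
  have hsum : ∀ y, ∑ k, f k y = m * F y := fun y => by
    rw [hF]
    field_simp
  have hbregman : ∀ y,
      ∑ k, ⟪gradient (f k) y - gradient (f k) xstar,
        P (gradient (f k) y - gradient (f k) xstar)⟫ ≤ 2 * β * (m * (F y - F xstar)) := by
    intro y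
    refine (Finset.sum_le_sum fun k _ =>
      (hconv k).inner_gradient_sub_le hβ hQP (hdiff k) (hsmooth k) xstar y).trans_eq ?_
    rw [← Finset.mul_sum, Finset.sum_sub_distrib, Finset.sum_sub_distrib, ← sum_inner, hgrad,
      hstar, smul_zero, inner_zero_left, hsum, hsum]
    ring
  have hcenter := sum_inner_map_sub_mean_le hP
    (fun k => gradient (f k) xtil - gradient (f k) xstar) (c := gradient F xtil) (by
      rw [Finset.sum_sub_distrib, hgrad, hgrad, hstar, smul_zero, sub_zero, Fintype.card_fin])
  have htotal : ∑ k, ⟪gradient (f k) x - gradient (f k) xtil + gradient F xtil,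
      P (gradient (f k) x - gradient (f k) xtil + gradient F xtil)⟫ ≤
      m * (4 * β * ((F x - F xstar) + (F xtil - F xstar))) := by
    have hsplit : ∀ k, gradient (f k) x - gradient (f k) xtil + gradient F xtil =
        (gradient (f k) x - gradient (f k) xstar) -
          (gradient (f k) xtil - gradient (f k) xstar - gradient F xtil) := fun k => by abel
    simp only [hsplit]
    refine (Finset.sum_le_sum fun k _ => inner_map_sub_le_two_mul hP _ _).trans ?_
    rw [Finset.sum_add_distrib, ← Finset.mul_sum, ← Finset.mul_sum]
    linarith [hbregman x, hbregman xtil]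
  rw [one_div, inv_mul_le_iff₀ (by positivity)]
  exact htotal
end

section
/- Let f : ℝ^d → ℝ, let x ∈ ℝ^d, let H be a d×d real symmetric positive definite matrix, let g ∈ ℝ^d, and set λ = √(gᵀH⁻¹g). Suppose that for all h ∈ ℝ^d with √(hᵀH·h) < 1 one has f(x + h) ≤ f(x) + ⟨g, h⟩ + ρ(√(hᵀH·h)), where ρ(s) = −ln(1 − s) − s. Then for every γ ≥ 1, the damped Newton iterate x⁺ = x − (1/(γ·(1 + λ)))·H⁻¹·g satisfies f(x⁺) ≤ f(x) − λ/γ + ln(1 + λ/(γ + (γ − 1)·λ)). -/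
open Matrix
open scoped RealInnerProductSpace

/-- The Newton direction `H⁻¹ g` is mapped back to `g` by `H`. -/
theorem toEuclideanCLM_apply_inv_apply {d : ℕ} {H : Matrix (Fin d) (Fin d) ℝ}
    (hH : IsUnit H.det) (g : EuclideanSpace ℝ (Fin d)) :
    Matrix.toEuclideanCLM (𝕜 := ℝ) H (Matrix.toEuclideanCLM (𝕜 := ℝ) H⁻¹ g) = g := by
  rw [← mul_apply_eq_comp, ← map_mul, Matrix.mul_nonsing_inv _ hH, map_one]
  rfl

/-- A positive definite matrix has a nonnegative quadratic form on Euclidean space. -/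
theorem Matrix.PosDef.inner_toEuclideanCLM_nonneg {d : ℕ} {H : Matrix (Fin d) (Fin d) ℝ}
    (hH : H.PosDef) (v : EuclideanSpace ℝ (Fin d)) :
    0 ≤ ⟪v, Matrix.toEuclideanCLM (𝕜 := ℝ) H v⟫ := by
  have h := hH.posSemidef.dotProduct_mulVec_nonneg v.ofLp
  rw [EuclideanSpace.inner_eq_star_dotProduct, Matrix.ofLp_toEuclideanCLM, dotProduct_comm]
  exact h

/-- the per-step decrease of the damped Newton method for
self-concordant-like functions. With `λ = √(gᵀH⁻¹g)` and the local smoothness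
bound `f(x + h) ≤ f(x) + ⟨g, h⟩ + ρ(‖h‖_H)` for `‖h‖_H < 1`
(where `ρ(s) = −ln(1 − s) − s`), the damped Newton step
`x⁺ = x − (1/(γ(1 + λ)))·H⁻¹·g` with `γ ≥ 1` satisfies
`f(x⁺) ≤ f(x) − λ/γ + ln(1 + λ/(γ + (γ−1)λ))`. -/
theorem damped_newton_decrease {d : ℕ}
    (f : EuclideanSpace ℝ (Fin d) → ℝ) (x : EuclideanSpace ℝ (Fin d))
    (H : Matrix (Fin d) (Fin d) ℝ) (hHsymm : H.IsSymm) (hH : H.PosDef)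
    (g : EuclideanSpace ℝ (Fin d))
    (lam : ℝ) (hlam : lam = Real.sqrt ⟪g, Matrix.toEuclideanCLM (𝕜 := ℝ) H⁻¹ g⟫)
    (hsmooth : ∀ h : EuclideanSpace ℝ (Fin d),
      Real.sqrt ⟪h, Matrix.toEuclideanCLM (𝕜 := ℝ) H h⟫ < 1 →
      f (x + h) ≤ f x + ⟪g, h⟫ +
        (-Real.log (1 - Real.sqrt ⟪h, Matrix.toEuclideanCLM (𝕜 := ℝ) H h⟫) -
          Real.sqrt ⟪h, Matrix.toEuclideanCLM (𝕜 := ℝ) H h⟫))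
    (γ : ℝ) (hγ : 1 ≤ γ) :
    f (x - (1 / (γ * (1 + lam))) • Matrix.toEuclideanCLM (𝕜 := ℝ) H⁻¹ g) ≤
      f x - lam / γ + Real.log (1 + lam / (γ + (γ - 1) * lam)) := by
  set v := Matrix.toEuclideanCLM (𝕜 := ℝ) H⁻¹ g with hv
  have hHv : Matrix.toEuclideanCLM (𝕜 := ℝ) H v = g :=
    toEuclideanCLM_apply_inv_apply hH.det_pos.ne'.isUnit g
  have hnonneg : 0 ≤ ⟪g, v⟫ := by
    have h := hH.inner_toEuclideanCLM_nonneg v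
    rwa [hHv, real_inner_comm] at h
  have hlam0 : 0 ≤ lam := hlam ▸ Real.sqrt_nonneg _
  have hsq : ⟪g, v⟫ = lam ^ 2 := by rw [hlam, Real.sq_sqrt hnonneg]
  have hγ0 : 0 < γ := by linarith
  have hden : 0 < γ + (γ - 1) * lam := by nlinarith
  set t := 1 / (γ * (1 + lam)) with ht
  have ht0 : 0 ≤ t := by positivity
  have hnorm : Real.sqrt ⟪-(t • v), Matrix.toEuclideanCLM (𝕜 := ℝ) H (-(t • v))⟫ = t * lam := by
    rw [map_neg, map_smul, hHv, inner_neg_neg, real_inner_smul_left, real_inner_smul_right,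
      real_inner_comm, hsq, show t * (t * lam ^ 2) = (t * lam) ^ 2 by ring,
      Real.sqrt_sq (by positivity)]
  have hgap : 1 - t * lam = (1 + lam / (γ + (γ - 1) * lam))⁻¹ := by
    have hsum : 1 + lam / (γ + (γ - 1) * lam) = γ * (1 + lam) / (γ + (γ - 1) * lam) := by
      rw [one_add_div hden.ne']
      ring
    rw [hsum, inv_div, ht]
    field_simp
    ring
  have hlt : t * lam < 1 := by
    have : 0 < 1 - t * lam := by rw [hgap]; positivity
    linarith
  have hstep : t * lam ^ 2 + t * lam = lam / γ := by
    rw [ht]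
    field_simp
    ring
  have hbound := hsmooth (-(t • v)) (by rwa [hnorm])
  rw [hnorm, hgap, Real.log_inv, inner_neg_right, real_inner_smul_right, hsq,
    ← sub_eq_add_neg x] at hbound
  linarith
end

section
/- Let γ > 1 and 0 < r < 1 be real numbers, and let λ ≥ r/(1 + r). Then λ/γ − ln(1 + λ/(γ + (γ − 1)·λ)) ≥ (r/(1 + r))·(1/γ − 1/(γ + (γ − 1)·r/(1 + r))), and this lower bound is strictly positive. -/
/-- The gap `1/γ − 1/(γ + (γ−1)x)` is positive for `γ > 1` and `x > 0`. -/
theorem one_div_sub_one_div_damped_pos {γ x : ℝ} (hγ : 1 < γ) (hx : 0 < x) :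
    0 < 1 / γ - 1 / (γ + (γ - 1) * x) :=
  sub_pos.2 <| one_div_lt_one_div_of_lt (by linarith) <|
    lt_add_of_pos_right _ (mul_pos (sub_pos.2 hγ) hx)

/-- The function `x ↦ x(1/γ − 1/(γ + (γ−1)x))` is monotone on the positive reals. -/
theorem mul_one_div_sub_one_div_damped_le {γ x y : ℝ} (hγ : 1 < γ) (hx : 0 < x) (hxy : x ≤ y) :
    x * (1 / γ - 1 / (γ + (γ - 1) * x)) ≤ y * (1 / γ - 1 / (γ + (γ - 1) * y)) := by
  have hγ' : 0 < γ - 1 := sub_pos.2 hγ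
  have hden : 0 < γ + (γ - 1) * x := by positivity
  have hgap : 1 / γ - 1 / (γ + (γ - 1) * x) ≤ 1 / γ - 1 / (γ + (γ - 1) * y) := by gcongr
  exact mul_le_mul hxy hgap (one_div_sub_one_div_damped_pos hγ hx).le (hx.le.trans hxy)

/-- for `γ > 1`, `0 < r < 1` and `λ ≥ r/(1+r)`, the damped Newton
per-step decrease satisfies
`λ/γ − ln(1 + λ/(γ + (γ−1)λ)) ≥ (r/(1+r))·(1/γ − 1/(γ + (γ−1)·r/(1+r)))`,
and this lower bound is strictly positive. -/
theorem damped_newton_scalar_decrease (γ r lam : ℝ) (hγ : 1 < γ)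
    (hr0 : 0 < r) (hr1 : r < 1) (hlam : r / (1 + r) ≤ lam) :
    (r / (1 + r)) * (1 / γ - 1 / (γ + (γ - 1) * r / (1 + r))) ≤
        lam / γ - Real.log (1 + lam / (γ + (γ - 1) * lam)) ∧
      0 < (r / (1 + r)) * (1 / γ - 1 / (γ + (γ - 1) * r / (1 + r))) := by
  have hs : 0 < r / (1 + r) := by positivity
  have hl : 0 < lam := hs.trans_le hlam
  have hγ' : 0 < γ - 1 := sub_pos.2 hγ
  rw [mul_div_assoc]
  refine ⟨(mul_one_div_sub_one_div_damped_le hγ hs hlam).trans ?_,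
    mul_pos hs (one_div_sub_one_div_damped_pos hγ hs)⟩
  have hlog := Real.log_le_sub_one_of_pos
    (show 0 < 1 + lam / (γ + (γ - 1) * lam) by positivity)
  rw [mul_sub, mul_one_div, mul_one_div]
  linarith
end
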